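/- arXiv:math/9807083 — 2 statements merged into one kernel-verified Lean document; each statement's English description precedes it below -/
import Mathlib

section
/- Under the projective Lelieuvre relations in asymptotic coordinates, at every point p ∈ ℝ² one has f·⟨f_x,ν_y⟩ = [ν,ν_x,ν_y] = f·⟨f_y,ν_x⟩ (in particular ⟨f_x,ν_y⟩ = ⟨f_y,ν_x⟩), and ⟨f_x,ν_y⟩² = det(ν,ν_x,ν_y,ν_{xy}). -/
noncomputable section

/-- Euclidean pairing on `ℝ⁴`. -/
def dot4 (a b : Fin 4 → ℝ) : ℝ := ∑ i, a i * b i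

/-- Determinant of the 4×4 matrix with rows `a, b, c, d`. -/
def det4 (a b c d : Fin 4 → ℝ) : ℝ := Matrix.det (Matrix.of ![a, b, c, d])

/-- Partial derivative in the first (`x`) variable. -/
def dx (g : ℝ × ℝ → Fin 4 → ℝ) : ℝ × ℝ → Fin 4 → ℝ := fun p => fderiv ℝ g p (1, 0)

/-- Partial derivative in the second (`y`) variable. -/
def dy (g : ℝ × ℝ → Fin 4 → ℝ) : ℝ × ℝ → Fin 4 → ℝ := fun p => fderiv ℝ g p (0, 1)

lemma dot4_comm (a b : Fin 4 → ℝ) : dot4 a b = dot4 b a := by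
  simp only [dot4, mul_comm]

/-- The pairing with all vectors determines a vector. -/
lemma eq_of_dot4_eq {a b : Fin 4 → ℝ} (h : ∀ w, dot4 w a = dot4 w b) : a = b := by
  funext i
  simpa [dot4, Pi.single_apply] using h (Pi.single i 1)

lemma dot4_self_ne_zero {a : Fin 4 → ℝ} (ha : a ≠ 0) : dot4 a a ≠ 0 :=
  fun h => ha (dotProduct_self_eq_zero.1 h)

lemma dot4_smul_right (w a : Fin 4 → ℝ) (c : ℝ) : dot4 w (c • a) = c * dot4 w a :=
  dotProduct_smul c w a

lemma det4_expand (a b c d : Fin 4 → ℝ) : det4 a b c d =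
    (a 0 * b 1 - a 1 * b 0) * (c 2 * d 3 - c 3 * d 2)
    - (a 0 * b 2 - a 2 * b 0) * (c 1 * d 3 - c 3 * d 1)
    + (a 0 * b 3 - a 3 * b 0) * (c 1 * d 2 - c 2 * d 1)
    + (a 1 * b 2 - a 2 * b 1) * (c 0 * d 3 - c 3 * d 0)
    - (a 1 * b 3 - a 3 * b 1) * (c 0 * d 2 - c 2 * d 0)
    + (a 2 * b 3 - a 3 * b 2) * (c 0 * d 1 - c 1 * d 0) := by
  simp [det4, Matrix.det_succ_row_zero, Fin.sum_univ_succ, Fin.succAbove]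
  ring

lemma det4_rotate_last (a b c d : Fin 4 → ℝ) : det4 a b c d = det4 a c d b := by
  rw [det4_expand, det4_expand]
  ring

lemma det4_swap_middle (a b c d : Fin 4 → ℝ) : det4 a b c d = -det4 a c b d := by
  rw [det4_expand, det4_expand]
  ring

lemma det4_rotate (a b c d : Fin 4 → ℝ) : det4 a b c d = -det4 b c d a := by
  rw [det4_expand, det4_expand]
  ring

lemma det4_self_second_third (a b c : Fin 4 → ℝ) : det4 a b b c = 0 := by
  rw [det4_expand]
  ring

/-- Leibniz rule for two fields whose pairing vanishes identically. -/
lemma dot4_fderiv_add_eq_zero {g h : ℝ × ℝ → Fin 4 → ℝ} (hg : Differentiable ℝ g)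
    (hh : Differentiable ℝ h) (h0 : ∀ p, dot4 (g p) (h p) = 0) (p v : ℝ × ℝ) :
    dot4 (fderiv ℝ g p v) (h p) + dot4 (g p) (fderiv ℝ h p v) = 0 := by
  have hsum : HasFDerivAt (fun q => ∑ i, g q i * h q i) _ p :=
    HasFDerivAt.fun_sum fun i _ =>
      (hasFDerivAt_pi'.1 (hg p).hasFDerivAt i).mul (hasFDerivAt_pi'.1 (hh p).hasFDerivAt i)
  have hzero : (fun q => ∑ i, g q i * h q i) = fun _ => 0 := funext h0
  rw [hzero] at hsum
  have := DFunLike.congr_fun (hsum.unique (hasFDerivAt_const 0 p)) v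
  simpa [dot4, Finset.sum_add_distrib, mul_comm, add_comm] using this

/-- If `f ∧ g = ± ⋆(ν ∧ μ)` with `f ≠ 0` and `⟨f, ν⟩ = 0`, then `⟨g, ν⟩ = 0`. -/
lemma dot4_eq_zero_of_wedge {f g ν μ : Fin 4 → ℝ} {s : ℝ} (hf : f ≠ 0) (hν : dot4 f ν = 0)
    (h : ∀ w z, dot4 w f * dot4 z g - dot4 z f * dot4 w g = s * det4 w z ν μ) :
    dot4 g ν = 0 := by
  have := h f ν
  rw [det4_self_second_third, dot4_comm ν f, hν, zero_mul, sub_zero, mul_zero] at this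
  rw [dot4_comm]
  exact (mul_eq_zero.1 this).resolve_left (dot4_self_ne_zero hf)

theorem stmt1 (f ν : ℝ × ℝ → Fin 4 → ℝ)
    (hsf : ContDiff ℝ (⊤ : ℕ∞) f) (hsν : ContDiff ℝ (⊤ : ℕ∞) ν)
    (hpair : ∀ p, dot4 (f p) (ν p) = 0)
    (hLx : ∀ p, ∀ w z : Fin 4 → ℝ,
      dot4 w (f p) * dot4 z (dx f p) - dot4 z (f p) * dot4 w (dx f p)
        = det4 w z (ν p) (dx ν p))
    (hLy : ∀ p, ∀ w z : Fin 4 → ℝ,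
      dot4 w (f p) * dot4 z (dy f p) - dot4 z (f p) * dot4 w (dy f p)
        = - det4 w z (ν p) (dy ν p))
    (hf0 : ∀ p, f p ≠ 0)
    (tr : (Fin 4 → ℝ) → (Fin 4 → ℝ) → (Fin 4 → ℝ) → (Fin 4 → ℝ))
    (htr : ∀ w a b c : Fin 4 → ℝ, dot4 w (tr a b c) = det4 w a b c) :
    ∀ p : ℝ × ℝ,
      dot4 (dx f p) (dy ν p) • f p = tr (ν p) (dx ν p) (dy ν p) ∧
      dot4 (dy f p) (dx ν p) • f p = tr (ν p) (dx ν p) (dy ν p) ∧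
      dot4 (dx f p) (dy ν p) = dot4 (dy f p) (dx ν p) ∧
      (dot4 (dx f p) (dy ν p)) ^ 2 = det4 (ν p) (dx ν p) (dy ν p) (dy (dx ν) p) := by
  have hdf : Differentiable ℝ f := hsf.differentiable (by simp)
  have hdν : Differentiable ℝ ν := hsν.differentiable (by simp)
  have hdνx : Differentiable ℝ (dx ν) :=
    ((hsν.fderiv_right (m := 1) (by norm_cast)).clm_apply contDiff_const).differentiable
      (by simp)
  have hνx : ∀ p, dot4 (f p) (dx ν p) = 0 := fun p => by
    have h : dot4 (dx f p) (ν p) = 0 :=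
      dot4_eq_zero_of_wedge (s := 1) (hf0 p) (hpair p) (by simpa using hLx p)
    have h' : dot4 (dx f p) (ν p) + dot4 (f p) (dx ν p) = 0 :=
      dot4_fderiv_add_eq_zero hdf hdν hpair p (1, 0)
    linarith
  have hνy : ∀ p, dot4 (f p) (dy ν p) = 0 := fun p => by
    have h : dot4 (dy f p) (ν p) = 0 :=
      dot4_eq_zero_of_wedge (s := -1) (hf0 p) (hpair p) (by simpa using hLy p)
    have h' : dot4 (dy f p) (ν p) + dot4 (f p) (dy ν p) = 0 :=
      dot4_fderiv_add_eq_zero hdf hdν hpair p (0, 1)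
    linarith
  intro p
  have hx : ∀ w, dot4 (dx f p) (dy ν p) * dot4 w (f p)
      = det4 w (ν p) (dx ν p) (dy ν p) := fun w => by
    have h := hLx p w (dy ν p)
    rw [dot4_comm _ (f p), dot4_comm _ (f p), hνy, det4_rotate_last] at h
    rw [← h, dot4_comm w, dot4_comm (dx f p)]
    ring
  have hy : ∀ w, dot4 (dy f p) (dx ν p) * dot4 w (f p)
      = det4 w (ν p) (dx ν p) (dy ν p) := fun w => by
    have h := hLy p w (dx ν p)
    rw [dot4_comm _ (f p), dot4_comm _ (f p), hνx, det4_swap_middle, neg_neg] at h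
    rw [← h, dot4_comm w, dot4_comm (dy f p)]
    ring
  have hxy : dot4 (dx f p) (dy ν p) = dot4 (dy f p) (dx ν p) :=
    mul_right_cancel₀ (dot4_self_ne_zero (hf0 p)) ((hx _).trans (hy _).symm)
  refine ⟨eq_of_dot4_eq fun w => ?_, eq_of_dot4_eq fun w => ?_, hxy, ?_⟩
  · rw [dot4_smul_right, htr, hx]
  · rw [dot4_smul_right, htr, hy]
  · have h : dot4 (dy f p) (dx ν p) + dot4 (f p) (dy (dx ν) p) = 0 :=
      dot4_fderiv_add_eq_zero hdf hdνx hνx p (0, 1)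
    have h' := hx (dy (dx ν) p)
    rw [det4_rotate, dot4_comm _ (f p), eq_neg_of_add_eq_zero_right h, ← hxy] at h'
    linarith
end
end

section
/- Under the projective Lelieuvre relations for hypersurfaces, the compatibility identity holds: for every point p ∈ ℝⁿ and all indices α, β, γ, δ ∈ {1,…,n}, A_{αγ}(p) · det(∂_β∂_δ ν, ν, ∂₁ν, …, ∂_nν)(p) = A_{βδ}(p) · det(∂_α∂_γ ν, ν, ∂₁ν, …, ∂_nν)(p); equivalently, det(A_{αγ} ∂_β∂_δ ν − A_{βδ} ∂_α∂_γ ν, ν, ∂₁ν, …, ∂_nν) = 0 at every point. -/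
noncomputable section

/-- Euclidean pairing on `ℝᵐ`. -/
def dotn {m : ℕ} (a b : Fin m → ℝ) : ℝ := ∑ i, a i * b i

/-- Partial derivative in the `α`-th variable of a map `ℝⁿ → ℝ^{n+2}`. -/
def pd {n : ℕ} (α : Fin n) (g : (Fin n → ℝ) → Fin (n + 2) → ℝ) :
    (Fin n → ℝ) → Fin (n + 2) → ℝ :=
  fun p => fderiv ℝ g p (Pi.single α 1)

/-- Determinant of the `(n+2) × (n+2)` matrix whose rows are `w`, `z`, and the `n`
vectors `v 0, …, v (n-1)`. -/
def detWZ {n : ℕ} (w z : Fin (n + 2) → ℝ) (v : Fin n → Fin (n + 2) → ℝ) : ℝ :=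
  Matrix.det (Matrix.of (Fin.cons w (Fin.cons z v)))

/-- Determinant of the `(n+2) × (n+2)` matrix whose rows are `w` and the `n+1`
vectors `v 0, …, v n`. -/
def detW {n : ℕ} (w : Fin (n + 2) → ℝ) (v : Fin (n + 1) → Fin (n + 2) → ℝ) : ℝ :=
  Matrix.det (Matrix.of (Fin.cons w v))

theorem dotn_sub_left {m : ℕ} (a b c : Fin m → ℝ) :
    dotn (a - b) c = dotn a c - dotn b c := by
  simp [dotn, sub_mul]

theorem dotn_smul_left {m : ℕ} (r : ℝ) (a c : Fin m → ℝ) :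
    dotn (r • a) c = r * dotn a c := by
  simp [dotn, Finset.mul_sum, mul_assoc]

theorem dotn_self_ne_zero {m : ℕ} {a : Fin m → ℝ} (ha : a ≠ 0) : dotn a a ≠ 0 :=
  fun h => ha (dotProduct_self_eq_zero.mp h)

/-- Laplace expansion along the first row. -/
theorem detW_eq_sum {n : ℕ} (w : Fin (n + 2) → ℝ) (v : Fin (n + 1) → Fin (n + 2) → ℝ) :
    detW w v = ∑ i : Fin (n + 2),
      (-1) ^ (i : ℕ) * w i * ((Matrix.of v).submatrix id i.succAbove).det :=
  Matrix.det_succ_row_zero _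

theorem detW_sub {n : ℕ} (w z : Fin (n + 2) → ℝ) (v : Fin (n + 1) → Fin (n + 2) → ℝ) :
    detW (w - z) v = detW w v - detW z v := by
  rw [detW_eq_sum, detW_eq_sum, detW_eq_sum, ← Finset.sum_sub_distrib]
  exact Finset.sum_congr rfl fun i _ => by rw [Pi.sub_apply]; ring

theorem detW_smul {n : ℕ} (r : ℝ) (w : Fin (n + 2) → ℝ)
    (v : Fin (n + 1) → Fin (n + 2) → ℝ) : detW (r • w) v = r * detW w v := by
  rw [detW_eq_sum, detW_eq_sum, Finset.mul_sum]
  exact Finset.sum_congr rfl fun i _ => by rw [Pi.smul_apply, smul_eq_mul]; ring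

/-- A determinant all of whose rows are orthogonal to a nonzero vector vanishes. -/
theorem detW_eq_zero_of_orthogonal {n : ℕ} {a w : Fin (n + 2) → ℝ}
    {v : Fin (n + 1) → Fin (n + 2) → ℝ} (ha : a ≠ 0) (hw : dotn w a = 0)
    (hv : ∀ i, dotn (v i) a = 0) : detW w v = 0 := by
  refine Matrix.exists_mulVec_eq_zero_iff.mp ⟨a, ha, ?_⟩
  funext i
  refine Fin.cases ?_ (fun j => ?_) i
  · exact hw
  · exact hv j

/-- If `v 0, …, v n` are orthogonal to `a ≠ 0`, then `det(·, v 0, …, v n)` is a multiple of the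
pairing with `a`. -/
theorem exists_detW_eq_mul_dotn {n : ℕ} {a : Fin (n + 2) → ℝ}
    {v : Fin (n + 1) → Fin (n + 2) → ℝ} (ha : a ≠ 0) (hv : ∀ i, dotn (v i) a = 0) :
    ∃ c : ℝ, ∀ w, detW w v = c * dotn w a := by
  have haa := dotn_self_ne_zero ha
  refine ⟨detW a v / dotn a a, fun w => ?_⟩
  have h : detW (dotn a a • w - dotn w a • a) v = 0 :=
    detW_eq_zero_of_orthogonal ha
      (by rw [dotn_sub_left, dotn_smul_left, dotn_smul_left]; ring) hv
  rw [detW_sub, detW_smul, detW_smul] at h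
  field_simp
  linarith

theorem detWZ_eq_zero_of_eq {n : ℕ} (w z : Fin (n + 2) → ℝ) {v : Fin n → Fin (n + 2) → ℝ}
    {j : Fin n} (h : v j = z) : detWZ w z v = 0 :=
  Matrix.det_zero_of_row_eq (i := (0 : Fin (n + 1)).succ) (j := j.succ.succ)
    (fun e => (Fin.succ_ne_zero j) (Fin.succ_injective _ e).symm) h.symm

theorem detWZ_swap {n : ℕ} (w z : Fin (n + 2) → ℝ) (v : Fin n → Fin (n + 2) → ℝ) (k : Fin n) :
    detWZ w (v k) (fun j => if j = k then z else v j) = -detWZ w z v := by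
  have hne : (0 : Fin (n + 1)).succ ≠ k.succ.succ :=
    fun e => (Fin.succ_ne_zero k) (Fin.succ_injective _ e).symm
  have h := Matrix.det_permute (Equiv.swap (0 : Fin (n + 1)).succ k.succ.succ)
    (Matrix.of (Fin.cons w (Fin.cons z v) : Fin (n + 2) → Fin (n + 2) → ℝ))
  rw [Equiv.Perm.sign_swap hne] at h
  have hM : Matrix.of (Fin.cons w (Fin.cons (v k) fun j => if j = k then z else v j) :
        Fin (n + 2) → Fin (n + 2) → ℝ) =
      (Matrix.of (Fin.cons w (Fin.cons z v) : Fin (n + 2) → Fin (n + 2) → ℝ)).submatrix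
        (Equiv.swap (0 : Fin (n + 1)).succ k.succ.succ) id := by
    ext i l
    refine Fin.cases ?_ (fun i => Fin.cases ?_ (fun j => ?_) i) i
    · rw [Matrix.submatrix_apply, Equiv.swap_apply_of_ne_of_ne (Fin.succ_ne_zero _).symm
        (Fin.succ_ne_zero _).symm]
      rfl
    · rw [Matrix.submatrix_apply, Equiv.swap_apply_left]
      rfl
    · by_cases hj : j = k
      · subst hj
        rw [Matrix.submatrix_apply, Equiv.swap_apply_right]
        simp
      · rw [Matrix.submatrix_apply, Equiv.swap_apply_of_ne_of_ne
          (fun e => (Fin.succ_ne_zero j) (Fin.succ_injective _ e))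
          (fun e => hj (Fin.succ_injective _ (Fin.succ_injective _ e)))]
        simp [hj]
  rw [detWZ, hM, h]
  simp [detWZ]

/-- The product rule for the partial derivatives of an identically vanishing pairing. -/
theorem dotn_pd_add_dotn_pd_eq_zero {n : ℕ} {g h : (Fin n → ℝ) → Fin (n + 2) → ℝ}
    (hg : Differentiable ℝ g) (hh : Differentiable ℝ h) (H : ∀ p, dotn (g p) (h p) = 0)
    (β : Fin n) (p : Fin n → ℝ) :
    dotn (pd β g p) (h p) + dotn (g p) (pd β h p) = 0 := by
  have hgi := hasFDerivAt_pi'.mp (hg p).hasFDerivAt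
  have hhi := hasFDerivAt_pi'.mp (hh p).hasFDerivAt
  have hd := HasFDerivAt.fun_sum (u := Finset.univ) fun i _ => (hgi i).mul (hhi i)
  have h0 : HasFDerivAt (fun q => ∑ i, g q i * h q i) (0 : (Fin n → ℝ) →L[ℝ] ℝ) p := by
    rw [show (fun q => ∑ i, g q i * h q i) = fun _ => (0 : ℝ) from funext H]
    exact hasFDerivAt_const _ _
  have e := congrArg (fun L : (Fin n → ℝ) →L[ℝ] ℝ => L (Pi.single β 1)) (hd.unique h0)
  simp only [dotn, pd, ← Finset.sum_add_distrib]
  simp only [sum_apply, add_apply,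
    smul_apply, ContinuousLinearMap.comp_apply,
    ContinuousLinearMap.proj_apply, zero_apply, smul_eq_mul] at e
  rw [← e]
  exact Finset.sum_congr rfl fun i _ => by ring

theorem differentiable_pd {n : ℕ} {g : (Fin n → ℝ) → Fin (n + 2) → ℝ}
    (hg : ContDiff ℝ (⊤ : ℕ∞) g) (α : Fin n) : Differentiable ℝ (pd α g) :=
  ((hg.fderiv_right (m := (⊤ : ℕ∞)) le_rfl).clm_apply contDiff_const).differentiable (by simp)

theorem stmt14 (n : ℕ) (hn : 1 ≤ n)
    (f ν : (Fin n → ℝ) → Fin (n + 2) → ℝ)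
    (A : Fin n → Fin n → (Fin n → ℝ) → ℝ)
    (hsf : ContDiff ℝ (⊤ : ℕ∞) f) (hsν : ContDiff ℝ (⊤ : ℕ∞) ν)
    (hsA : ∀ α β, ContDiff ℝ (⊤ : ℕ∞) (A α β))
    (hpair : ∀ p, dotn (f p) (ν p) = 0)
    (hL : ∀ p, ∀ α : Fin n, ∀ w z : Fin (n + 2) → ℝ,
      dotn w (f p) * dotn z (pd α f p) - dotn z (f p) * dotn w (pd α f p)
        = ∑ β : Fin n, A α β p *
            detWZ w z (fun j => if j = β then ν p else pd j ν p))
    (hf0 : ∀ p, f p ≠ 0) :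
    ∀ p : Fin n → ℝ, ∀ α β γ δ : Fin n,
      A α γ p * detW (pd β (pd δ ν) p) (Fin.cons (ν p) (fun j => pd j ν p))
        = A β δ p * detW (pd α (pd γ ν) p) (Fin.cons (ν p) (fun j => pd j ν p)) ∧
      detW (A α γ p • pd β (pd δ ν) p - A β δ p • pd α (pd γ ν) p)
        (Fin.cons (ν p) (fun j => pd j ν p)) = 0 := by
  have hdf : Differentiable ℝ f := hsf.differentiable (by simp)
  have hdν : Differentiable ℝ ν := hsν.differentiable (by simp)
  have hνf : ∀ p, dotn (ν p) (f p) = 0 := fun p => (dotProduct_comm _ _).trans (hpair p)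
  have hνfα : ∀ p α, dotn (ν p) (pd α f p) = 0 := fun p α => by
    have h := hL p α (f p) (ν p)
    rw [Finset.sum_eq_zero fun β _ => by
      rw [detWZ_eq_zero_of_eq _ _ (j := β) (if_pos rfl), mul_zero], hνf, zero_mul, sub_zero] at h
    exact (mul_eq_zero.mp h).resolve_left (dotn_self_ne_zero (hf0 p))
  have hναf : ∀ p α, dotn (pd α ν p) (f p) = 0 := fun p α => by
    have h := dotn_pd_add_dotn_pd_eq_zero hdν hdf hνf α p
    rwa [hνfα, add_zero] at h
  intro p α β γ δ
  obtain ⟨c, hc⟩ := exists_detW_eq_mul_dotn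
    (v := Fin.cons (ν p) (fun j => pd j ν p)) (hf0 p) (Fin.cases (hνf p) fun j => hναf p j)
  have hA : ∀ α γ, dotn (pd γ ν p) (pd α f p) = -(c * A α γ p) := fun α γ => by
    have h := hL p α (f p) (pd γ ν p)
    rw [Finset.sum_eq_single γ (fun β _ hβ => by
        rw [detWZ_eq_zero_of_eq _ _ (j := γ) (if_neg hβ.symm), mul_zero]) (by simp),
      detWZ_swap (f p) (ν p) (fun j => pd j ν p) γ, hναf, zero_mul, sub_zero,
      show detWZ (f p) (ν p) (fun j => pd j ν p) = c * dotn (f p) (f p) from hc (f p)] at h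
    apply mul_left_cancel₀ (dotn_self_ne_zero (hf0 p))
    linarith
  have hdet : ∀ β δ, detW (pd β (pd δ ν) p) (Fin.cons (ν p) (fun j => pd j ν p)) =
      c ^ 2 * A β δ p := fun β δ => by
    have h := dotn_pd_add_dotn_pd_eq_zero (differentiable_pd hsν δ) hdf (hναf · δ) β p
    rw [hA] at h
    rw [hc, eq_neg_of_add_eq_zero_left h]
    ring
  rw [detW_sub, detW_smul, detW_smul, hdet, hdet]
  constructor <;> ring
end
end
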